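/- arXiv:1111.5342 — 2 statements merged into one kernel-verified Lean document; each statement's English description precedes it below -/
import Mathlib

section
/- Let $p$ be a prime and $n, N \geq 1$ integers. The formal power series over $\mathbb{Q}_p$ whose coefficient of $X^m$ equals $\binom{p^{-n}}{k}$ when $m = Nk$ for some $k \in \mathbb{N}$, and equals $0$ when $N \nmid m$, has radius of convergence exactly $p^{-(n + \frac{1}{p-1})/N}$; that is, $\sup\{r \geq 0 : \text{the sequence } (|\binom{p^{-n}}{k}|_p\, r^{Nk})_{k\in\mathbb{N}} \text{ is bounded}\} = p^{-(n+\frac{1}{p-1})/N}$. -/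
open scoped NNReal ENNReal

/-- `‖(p⁻ⁿ choose k)‖ = p ^ (n * k + v_p(k!))` in `ℚ_p`. -/
theorem norm_binomial_inv_pow (p : ℕ) [Fact p.Prime] (n : ℕ) (hn : 1 ≤ n) (k : ℕ) :
    ‖(1 / (k.factorial : ℚ_[p])) *
        ∏ j ∈ Finset.range k, (((p : ℚ_[p]) ^ n)⁻¹ - (j : ℚ_[p]))‖
      = (p : ℝ) ^ ((n : ℝ) * k + padicValNat p k.factorial) := by
  have hp : 1 < p := (Fact.out : p.Prime).one_lt
  have hp0 : (0 : ℝ) < p := by positivity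
  have hterm (j : ℕ) : ‖((p : ℚ_[p]) ^ n)⁻¹ - (j : ℚ_[p])‖ = (p : ℝ) ^ n := by
    have h1 : ‖((p : ℚ_[p]) ^ n)⁻¹‖ = (p : ℝ) ^ n := by
      rw [norm_inv, norm_pow, Padic.norm_p, inv_pow, inv_inv]
    have h2 : ‖(j : ℚ_[p])‖ ≤ 1 := by
      exact_mod_cast Padic.norm_int_le_one (p := p) (j : ℤ)
    have h3 : (1 : ℝ) < (p : ℝ) ^ n := one_lt_pow₀ (by exact_mod_cast hp) (by omega)
    have h4 : ‖((p : ℚ_[p]) ^ n)⁻¹‖ ≠ ‖-(j : ℚ_[p])‖ := by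
      rw [h1, norm_neg]; linarith
    rw [sub_eq_add_neg, Padic.add_eq_max_of_ne h4, h1, norm_neg]
    exact max_eq_left (by linarith)
  have hfac : ‖(k.factorial : ℚ_[p])‖ = (p : ℝ) ^ (-(padicValNat p k.factorial : ℝ)) := by
    rw [Padic.norm_eq_zpow_neg_valuation (by exact_mod_cast k.factorial_ne_zero),
      Padic.valuation_natCast, ← Real.rpow_intCast]
    simp
  rw [norm_mul, norm_div, norm_one, norm_prod, Finset.prod_congr rfl fun j _ => hterm j,
    Finset.prod_const, Finset.card_range, hfac, Real.rpow_neg hp0.le, one_div, inv_inv,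
    Real.rpow_add hp0, ← pow_mul, ← Real.rpow_natCast (p : ℝ) (n * k), mul_comm]
  push_cast
  rfl

theorem sub_one_mul_padicValNat_factorial_pow (p : ℕ) [Fact p.Prime] (m : ℕ) :
    ((p : ℝ) - 1) * padicValNat p (p ^ m).factorial = (p : ℝ) ^ m - 1 := by
  induction m with
  | zero => simp
  | succ m ih =>
    rw [pow_succ', padicValNat_factorial_mul]
    push_cast
    rw [mul_add, ih]
    ring

/-- `p^{-(n + 1/(p-1))/N}` normalizes the binomial coefficients up to the factor
`p ^ (v_p(k!) - k/(p-1))`. -/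
theorem norm_binomial_inv_pow_mul_radius_pow (p : ℕ) [Fact p.Prime] (n N : ℕ) (hn : 1 ≤ n)
    (hN : 1 ≤ N) (k : ℕ) :
    ‖(1 / (k.factorial : ℚ_[p])) *
        ∏ j ∈ Finset.range k, (((p : ℚ_[p]) ^ n)⁻¹ - (j : ℚ_[p]))‖ *
      ((p : ℝ) ^ (-(((n : ℝ) + 1 / ((p : ℝ) - 1)) / (N : ℝ)))) ^ (N * k)
      = (p : ℝ) ^ ((padicValNat p k.factorial : ℝ) - k / ((p : ℝ) - 1)) := by
  have hp0 : (0 : ℝ) < p := by exact_mod_cast (Fact.out : p.Prime).pos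
  have hN0 : (N : ℝ) ≠ 0 := by positivity
  rw [norm_binomial_inv_pow p n hn k, ← Real.rpow_natCast, ← Real.rpow_mul hp0.le,
    ← Real.rpow_add hp0]
  congr 1
  push_cast
  field_simp
  ring

/-- Let `p` be a prime and `n, N ≥ 1`. The power series over `ℚ_p` whose coefficient of
`X^m` is the generalized binomial coefficient `(p⁻ⁿ choose k)` when `m = N·k`, and `0`
otherwise, has radius of convergence exactly `p^{-(n + 1/(p-1))/N}`; i.e. the supremum of
the radii `r` for which the sequence `(‖(p⁻ⁿ choose k)‖ · r^(N·k))ₖ` is bounded equals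
`p^{-(n + 1/(p-1))/N}`. -/
theorem stmt4 (p : ℕ) [Fact p.Prime] (n N : ℕ) (hn : 1 ≤ n) (hN : 1 ≤ N)
    (B : ℕ → ℚ_[p])
    (hB : ∀ k : ℕ, B k = (1 / (k.factorial : ℚ_[p])) *
        ∏ j ∈ Finset.range k, (((p : ℚ_[p]) ^ n)⁻¹ - (j : ℚ_[p]))) :
    (⨆ (r : ℝ≥0) (_ : ∃ M : ℝ, ∀ k : ℕ, ‖B k‖ * (r : ℝ) ^ (N * k) ≤ M), (r : ℝ≥0∞))
      = ENNReal.ofReal ((p : ℝ) ^ (-(((n : ℝ) + 1 / ((p : ℝ) - 1)) / (N : ℝ)))) := by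
  have hp : 1 < p := (Fact.out : p.Prime).one_lt
  have hp1 : (1 : ℝ) < p := by exact_mod_cast hp
  have hp0 : (0 : ℝ) < p := by linarith
  have hps : (0 : ℝ) < (p : ℝ) - 1 := by linarith
  have key (k : ℕ) := norm_binomial_inv_pow_mul_radius_pow p n N hn hN k
  simp only [← hB] at key
  set R : ℝ := (p : ℝ) ^ (-(((n : ℝ) + 1 / ((p : ℝ) - 1)) / (N : ℝ))) with hR
  have hR0 : 0 < R := Real.rpow_pos_of_pos hp0 _
  apply le_antisymm
  · refine iSup₂_le fun r ⟨M, hM⟩ => ?_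
    rw [← ENNReal.ofReal_coe_nnreal]
    refine ENNReal.ofReal_le_ofReal ?_
    by_contra! hlt
    set c : ℝ := (p : ℝ) ^ (-(1 / ((p : ℝ) - 1)))
    have hc : 0 < c := Real.rpow_pos_of_pos hp0 _
    have hq : 1 < ((r : ℝ) / R) ^ N := one_lt_pow₀ ((one_lt_div hR0).2 hlt) (by omega)
    obtain ⟨m, hm⟩ := pow_unbounded_of_one_lt (M / c) hq
    have hpow : (((r : ℝ) / R) ^ N) ^ m ≤ (((r : ℝ) / R) ^ N) ^ (p ^ m) :=
      pow_le_pow_right₀ hq.le (Nat.lt_pow_self hp).le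
    have hval : ‖B (p ^ m)‖ * R ^ (N * p ^ m) = c := by
      rw [key]
      congr 1
      have h := sub_one_mul_padicValNat_factorial_pow p m
      push_cast
      field_simp
      linarith
    have hsplit : ‖B (p ^ m)‖ * (r : ℝ) ^ (N * p ^ m) = c * (((r : ℝ) / R) ^ N) ^ (p ^ m) := by
      rw [← hval, ← pow_mul, div_pow]
      field_simp
    have hle := hM (p ^ m)
    rw [hsplit] at hle
    rw [div_lt_iff₀ hc] at hm
    nlinarith
  · refine le_iSup₂_of_le (Real.toNNReal R) ⟨1, fun k => ?_⟩ le_rfl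
    rw [Real.coe_toNNReal _ hR0.le, key]
    refine Real.rpow_le_one_of_one_le_of_nonpos hp1.le ?_
    have h : (p - 1) * padicValNat p k.factorial ≤ k := by
      rw [sub_one_mul_padicValNat_factorial]
      exact Nat.sub_le _ _
    have h' : ((p : ℝ) - 1) * padicValNat p k.factorial ≤ k := by
      rw [← Nat.cast_pred (by omega)]
      exact_mod_cast h
    rw [sub_nonpos, le_div_iff₀ hps]
    linarith
end

section
/- Let $p$ be a prime and $L$ a normed field whose norm is multiplicative and ultrametric, and such that the image of $p$ in $L$ has norm $p^{-1}$. If $y \in L$ satisfies $\|(1+y)^p - 1\| = p^{-\frac{p}{p-1}}$, then $\|y\| = p^{-\frac{1}{p-1}}$. -/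
/-- In an ultrametric normed field, `(1 + y) ^ p - 1 - y ^ p` has norm at most `‖p‖ * M` as soon as
`M` bounds `‖y‖ ^ k` for `0 < k < p`. -/
theorem norm_one_add_pow_prime_sub_le {L : Type*} [NormedField L] [IsUltrametricDist L] {p : ℕ}
    (hp : p.Prime) (y : L) {M : ℝ} (hM0 : 0 ≤ M) (hM : ∀ k, 0 < k → k < p → ‖y‖ ^ k ≤ M) :
    ‖(1 + y) ^ p - 1 - y ^ p‖ ≤ ‖(p : L)‖ * M := by
  have h : (1 + y) ^ p - 1 - y ^ p =
      p * ∑ k ∈ Finset.Ioo 0 p, y ^ k * 1 ^ (p - k) * ((p.choose k / p : ℕ) : L) := by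
    rw [add_comm, add_pow_prime_eq' hp y 1]
    ring
  rw [h, norm_mul]
  refine mul_le_mul_of_nonneg_left ?_ (norm_nonneg _)
  refine IsUltrametricDist.norm_sum_le_of_forall_le_of_nonneg hM0 fun k hk => ?_
  rw [Finset.mem_Ioo] at hk
  rw [one_pow, mul_one, norm_mul, norm_pow]
  exact (mul_le_of_le_one_right (by positivity)
    (IsUltrametricDist.norm_natCast_le_one L _)).trans (hM k hk.1 hk.2)

/-- Let `p` be a prime and `L` a normed field whose norm is ultrametric and such that
`‖p‖ = p⁻¹` in `L`. If `y ∈ L` satisfies `‖(1+y)^p - 1‖ = p^{-p/(p-1)}`, then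
`‖y‖ = p^{-1/(p-1)}`. -/
theorem stmt6 (p : ℕ) (hp : p.Prime) (L : Type*) [NormedField L]
    (hultra : ∀ a b : L, ‖a + b‖ ≤ max ‖a‖ ‖b‖)
    (hnormp : ‖(p : L)‖ = ((p : ℝ))⁻¹)
    (y : L) (hy : ‖(1 + y) ^ p - 1‖ = (p : ℝ) ^ (-(p : ℝ) / ((p : ℝ) - 1))) :
    ‖y‖ = (p : ℝ) ^ (-(1 : ℝ) / ((p : ℝ) - 1)) := by
  have : IsUltrametricDist L := IsUltrametricDist.isUltrametricDist_of_isNonarchimedean_norm hultra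
  have hp1 : (1 : ℝ) < p := by exact_mod_cast hp.one_lt
  have hp0 : (0 : ℝ) < p := by linarith
  have hpsub : (p : ℝ) - 1 ≠ 0 := by linarith
  set r : ℝ := (p : ℝ) ^ (-(1 : ℝ) / ((p : ℝ) - 1)) with hr
  have hr0 : 0 < r := Real.rpow_pos_of_pos hp0 _
  have hr1 : r < 1 := Real.rpow_lt_one_of_one_lt_of_neg hp1
    (div_neg_of_neg_of_pos (by norm_num) (by linarith))
  have hrp : (p : ℝ) ^ (-(p : ℝ) / ((p : ℝ) - 1)) = r ^ p := by
    rw [hr, ← Real.rpow_natCast, ← Real.rpow_mul hp0.le]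
    congr 1
    ring
  have hrp1 : r ^ (p - 1) = (p : ℝ)⁻¹ := by
    rw [hr, ← Real.rpow_natCast, ← Real.rpow_mul hp0.le, Nat.cast_sub hp.one_le, Nat.cast_one,
      div_mul_cancel₀ _ hpsub, Real.rpow_neg_one]
  have hpow : ∀ t : ℝ, t ^ p = t ^ (p - 1) * t := fun t => (pow_sub_one_mul hp.ne_zero t).symm
  have hpne : p - 1 ≠ 0 := by have := hp.two_le; omega
  rw [hrp] at hy
  have hsplit : (1 + y) ^ p - 1 = ((1 + y) ^ p - 1 - y ^ p) + y ^ p := by ring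
  rcases lt_trichotomy ‖y‖ r with hlt | heq | hgt
  · exfalso
    have hA := norm_one_add_pow_prime_sub_le hp y (norm_nonneg y) fun k hk _ =>
      pow_le_of_le_one (norm_nonneg y) (hlt.trans hr1).le hk.ne'
    have hA' : ‖(1 + y) ^ p - 1 - y ^ p‖ < r ^ p := by
      refine hA.trans_lt ?_
      rw [hnormp, hpow r, hrp1]
      exact mul_lt_mul_of_pos_left hlt (by positivity)
    have hB : ‖y ^ p‖ < r ^ p := by
      rw [norm_pow]
      exact pow_lt_pow_left₀ hlt (norm_nonneg y) hp.ne_zero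
    have := hultra ((1 + y) ^ p - 1 - y ^ p) (y ^ p)
    rw [← hsplit, hy] at this
    exact (this.trans_lt (max_lt hA' hB)).false
  · exact heq
  · exfalso
    have hy0 : 0 < ‖y‖ := hr0.trans hgt
    have hA : ‖(1 + y) ^ p - 1 - y ^ p‖ < ‖y ^ p‖ := by
      rw [norm_pow]
      rcases le_total ‖y‖ 1 with h1 | h1
      · refine (norm_one_add_pow_prime_sub_le hp y (norm_nonneg y) fun k hk _ =>
          pow_le_of_le_one (norm_nonneg y) h1 hk.ne').trans_lt ?_
        rw [hnormp, hpow ‖y‖, ← hrp1]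
        exact mul_lt_mul_of_pos_right (pow_lt_pow_left₀ hgt hr0.le hpne) hy0
      · refine (norm_one_add_pow_prime_sub_le hp y (M := ‖y‖ ^ p) (by positivity) fun k _ hk =>
          pow_le_pow_right₀ h1 hk.le).trans_lt ?_
        rw [hnormp]
        exact mul_lt_of_lt_one_left (by positivity) (inv_lt_one_of_one_lt₀ hp1)
    have hmax := IsUltrametricDist.norm_add_eq_max_of_norm_ne_norm hA.ne
    rw [← hsplit, hy, max_eq_right hA.le, norm_pow] at hmax
    exact (pow_lt_pow_left₀ hgt hr0.le hp.ne_zero).ne hmax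
end
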